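/- arXiv:1904.10007 — 9 statements merged into one kernel-verified Lean document; each statement's English description precedes it below -/
import Mathlib

section
/- Let q ≥ 1 be an integer. For every integer λ with q·(q−1) ≤ λ < q³ there exist integers i and j with 0 ≤ i < q², 0 ≤ j < q, and λ = i·q + j·(q+1). (This is Lemma 2 of the paper: every integer in [2g, q³), where g = q(q−1)/2 is the genus of the Hermitian curve, lies in the set H*(Q) = {iq + j(q+1) : 0 ≤ i < q², 0 ≤ j < q}.) -/
/-- Lemma 2: every integer `λ` with `2g = q(q-1) ≤ λ < q³` lies in
`H*(Q) = {iq + j(q+1) : 0 ≤ i < q², 0 ≤ j < q}`. -/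
theorem stmt_0 (q : ℕ) (hq : 1 ≤ q) (lam : ℕ) (h₁ : q * (q - 1) ≤ lam)
    (h₂ : lam < q ^ 3) :
    ∃ i j : ℕ, i < q ^ 2 ∧ j < q ∧ lam = i * q + j * (q + 1) := by
  have hj : lam % q < q := Nat.mod_lt _ hq
  have hd : q - 1 ≤ lam / q := by
    rw [Nat.le_div_iff_mul_le hq, mul_comm]
    exact h₁
  have hu : lam / q < q ^ 2 := by
    rw [Nat.div_lt_iff_lt_mul hq]
    calc lam < q ^ 3 := h₂
      _ = q ^ 2 * q := by ring
  obtain ⟨i, hi⟩ : ∃ i, lam / q = i + lam % q := ⟨lam / q - lam % q, by omega⟩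
  refine ⟨i, lam % q, by omega, hj, ?_⟩
  have e := Nat.div_add_mod lam q
  rw [hi] at e
  calc lam = q * (i + lam % q) + lam % q := e.symm
    _ = i * q + lam % q * (q + 1) := by ring
end

section
/- Let q ≥ 1 be an integer and let S be the additive submonoid of ℕ generated by q and q+1. For every natural number n with n < q³, n ∈ S if and only if there exist integers i and j with 0 ≤ i < q², 0 ≤ j < q, and n = i·q + j·(q+1). (This identifies the set H*(Q) of the paper with the elements of the Weierstraß semigroup ⟨q, q+1⟩ below q³.) -/
/-- The set `H*(Q)` coincides with the elements of the Weierstraß semigroup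
`⟨q, q+1⟩` that are smaller than `q³`. -/
theorem stmt_1 (q : ℕ) (hq : 1 ≤ q)
    (S : AddSubmonoid ℕ) (hS : S = AddSubmonoid.closure {q, q + 1})
    (n : ℕ) (hn : n < q ^ 3) :
    n ∈ S ↔ ∃ i j : ℕ, i < q ^ 2 ∧ j < q ∧ n = i * q + j * (q + 1) := by
  subst hS
  rw [AddSubmonoid.mem_closure_pair]
  simp only [smul_eq_mul]
  constructor
  · rintro ⟨a, b, h⟩
    have hb := Nat.div_add_mod b q
    have key : n = (a + (b / q) * (q + 1)) * q + (b % q) * (q + 1) := by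
      rw [← h]
      nth_rewrite 1 [← hb]
      ring
    refine ⟨a + (b / q) * (q + 1), b % q, ?_, Nat.mod_lt _ hq, key⟩
    have h1 : (a + (b / q) * (q + 1)) * q < q ^ 2 * q := by
      calc _ ≤ n := by rw [key]; exact Nat.le_add_right _ _
        _ < q ^ 3 := hn
        _ = q ^ 2 * q := by ring
    exact Nat.lt_of_mul_lt_mul_right h1
  · rintro ⟨i, j, -, -, h⟩
    exact ⟨i, j, h.symm⟩
end

section
/- Let q ≥ 1 be an integer. Then {q³ − i·q − j·(q+1) : 0 ≤ i < q² − q, 0 ≤ j < q, i + j ≥ q² − q} = {a·q + b : 1 ≤ b ≤ a ≤ q − 1} as sets of natural numbers. (The image under σ(λ) = q³ − λ of the set Λ₂ is {q+1, 2q+1, 2q+2, 3q+1, 3q+2, 3q+3, …, (q−1)q + (q−1)}.) -/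
/-- The image of `Λ₂` under `σ(λ) = q³ - λ` is
`{aq + b : 1 ≤ b ≤ a ≤ q - 1}`. -/
theorem stmt_5 (q : ℕ) (hq : 1 ≤ q) :
    {n : ℕ | ∃ i j : ℕ, i < q ^ 2 - q ∧ j < q ∧ q ^ 2 - q ≤ i + j ∧
        n = q ^ 3 - (i * q + j * (q + 1))}
      = {n : ℕ | ∃ a b : ℕ, 1 ≤ b ∧ b ≤ a ∧ a ≤ q - 1 ∧ n = a * q + b} := by
  obtain ⟨p, rfl⟩ : ∃ p, q = p + 1 := ⟨q - 1, by omega⟩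
  obtain ⟨m, hm⟩ : ∃ m, m = p * p + p := ⟨_, rfl⟩
  have h1 : (p + 1) ^ 2 - (p + 1) = m := by
    have : (p + 1) ^ 2 = m + (p + 1) := by rw [hm]; ring
    omega
  have hpm : p ≤ m := by rw [hm]; exact Nat.le_add_left _ _
  -- the key identity
  have key : ∀ i j t a b : ℕ, i + j = m + t → a + t = p → b + j = p + 1 →
      (p + 1) ^ 3 - (i * (p + 1) + j * (p + 1 + 1)) = a * (p + 1) + b := by
    intro i j t a b e1 e2 e3
    have : (p + 1) ^ 3 = (a * (p + 1) + b) + (i * (p + 1) + j * (p + 1 + 1)) := by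
      have e4 : i * (p + 1) + j * (p + 1 + 1) = (i + j) * (p + 1) + j := by ring
      rw [e4, e1, hm]
      have e5 : (a * (p + 1) + b) + ((p * p + p + t) * (p + 1) + j)
          = (a + t) * (p + 1) + (b + j) + (p * p + p) * (p + 1) := by ring
      rw [e5, e2, e3]; ring
    omega
  rw [h1]
  ext n
  simp only [Set.mem_setOf_eq]
  constructor
  · rintro ⟨i, j, hi, hj, hij, rfl⟩
    exact ⟨p - (i + j - m), p + 1 - j, by omega, by omega, by omega,
      key i j (i + j - m) _ _ (by omega) (by omega) (by omega)⟩
  · rintro ⟨a, b, hb, hba, ha, rfl⟩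
    exact ⟨m + (p - a) - (p + 1 - b), p + 1 - b, by omega, by omega, by omega,
      (key _ _ (p - a) a b (by omega) (by omega) (by omega)).symm⟩
end

section
/- Let q ≥ 1 and let δ be an integer with 1 ≤ δ ≤ q², and write δ − 1 = a·q + b with 0 ≤ b < q. Then the number of pairs (a', b') of integers with 1 ≤ b' ≤ a' ≤ q − 1 and a'·q + b' < δ equals a·(a−1)/2 + min{a, b}. -/
/-- The number of pairs `(a', b')` with `1 ≤ b' ≤ a' ≤ q - 1` and
`a'·q + b' < δ` equals `a(a-1)/2 + min{a, b}`, where `δ - 1 = aq + b`,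
`0 ≤ b < q`. -/
theorem stmt_6 (q : ℕ) (hq : 1 ≤ q) (δ a b : ℕ) (hδ₁ : 1 ≤ δ) (hδ₂ : δ ≤ q ^ 2)
    (hab : δ - 1 = a * q + b) (hb : b < q) :
    Set.ncard {p : ℕ × ℕ | 1 ≤ p.2 ∧ p.2 ≤ p.1 ∧ p.1 ≤ q - 1 ∧
        p.1 * q + p.2 < δ}
      = a * (a - 1) / 2 + min a b := by
  have ha : a < q := by
    by_contra h
    push Not at h
    have : q * q ≤ a * q := Nat.mul_le_mul_right q h
    rw [pow_two] at hδ₂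
    omega
  have hset : {p : ℕ × ℕ | 1 ≤ p.2 ∧ p.2 ≤ p.1 ∧ p.1 ≤ q - 1 ∧ p.1 * q + p.2 < δ}
      = (Equiv.sigmaEquivProd ℕ ℕ) '' (((Finset.range (a + 1)).sigma
          (fun i => Finset.Icc 1 (if i < a then i else min a b)) : Finset (Σ _ : ℕ, ℕ)) :
            Set (Σ _ : ℕ, ℕ)) := by
    ext ⟨x, y⟩
    rw [Equiv.image_eq_preimage_symm]
    simp only [Set.mem_setOf_eq, Set.mem_preimage, Finset.mem_coe, Finset.mem_sigma,
      Finset.mem_range, Finset.mem_Icc, Equiv.sigmaEquivProd_symm_apply]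
    rcases lt_trichotomy x a with h | h | h
    · have h1 : (x + 1) * q ≤ a * q := Nat.mul_le_mul_right q h
      rw [add_mul] at h1
      rw [if_pos h]
      omega
    · subst h
      rw [if_neg (lt_irrefl _)]
      omega
    · have h1 : (a + 1) * q ≤ x * q := Nat.mul_le_mul_right q h
      rw [add_mul] at h1
      omega
  rw [hset, Set.ncard_image_of_injective _ (Equiv.injective _), Set.ncard_coe_finset,
    Finset.card_sigma, Finset.sum_range_succ, ← Finset.sum_range_id]
  congr 1
  · apply Finset.sum_congr rfl
    intro i hi
    rw [if_pos (Finset.mem_range.mp hi)]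
    simp
  · simp
end

section
/- Let q ≥ 1 be an integer, let δ be an integer with 1 ≤ δ ≤ q², and write δ − 1 = a·q + b with 0 ≤ b < q. Define σ(i, j) = q³ − i·q − j·(q+1) when 0 ≤ i < q² − q, and σ(i, j) = (q² − i)·(q − j) when q² − q ≤ i < q² (in both cases 0 ≤ j < q). Then the number of pairs (i, j) with 0 ≤ i < q², 0 ≤ j < q, and σ(i, j) ≥ δ equals q³ − q² − a·(a−1)/2 − min{a, b} + Σ_{s=δ}^{q²} τ⁽q⁾(s). (This is the combinatorial core of Proposition 2 of the paper, counting the generators of the order bound improved Hermitian code Ẽ(δ).) -/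
lemma aux_val (q i j u k : ℕ) (h1 : i + u + 1 + q = q ^ 2) (h2 : j + k = q) :
    q ^ 3 - (i * q + j * (q + 1)) = (u + k) * q + k := by
  have : q ^ 3 = (i * q + j * (q + 1)) + ((u + k) * q + k) := by
    have e : q ^ 3 = q ^ 2 * q := by ring
    rw [e, ← h1]
    have e2 : q * q = (j + k) * q := by rw [h2]
    have e3 : (i + u + 1 + q) * q = i * q + u * q + q + q * q := by ring
    rw [e3, e2]
    nlinarith
  omega

lemma aux_cond (q a b m k : ℕ) (hk1 : 1 ≤ k) (hk : k ≤ q) (hkm : k ≤ m) (hb : b < q) (ha : a < q) :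
    m * q + k ≤ a * q + b ↔ m < a ∨ (m = a ∧ k ≤ b) := by
  constructor
  · intro h
    rcases lt_trichotomy m a with h1 | h1 | h1
    · exact Or.inl h1
    · subst h1; exact Or.inr ⟨rfl, by omega⟩
    · exfalso
      have : (a + 1) * q ≤ m * q := Nat.mul_le_mul_right _ h1
      nlinarith
  · rintro (h | ⟨rfl, h⟩)
    · rcases Nat.lt_or_ge k q with h2 | h2
      · have : (m + 1) * q ≤ a * q := Nat.mul_le_mul_right _ h
        nlinarith
      · omega
    · omega

lemma bad_card (q a b : ℕ) (hb : b < q) (ha : a < q) :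
    (((Finset.range (q ^ 2 - q)) ×ˢ (Finset.range q)).filter
      (fun p => q ^ 3 - (p.1 * q + p.2 * (q + 1)) ≤ a * q + b)).card
      = a * (a - 1) / 2 + min a b := by
  have hS : ((Finset.range (a + 1)).sigma
      (fun m => Finset.Icc 1 (if m < a then m else min a b))).card
      = a * (a - 1) / 2 + min a b := by
    rw [Finset.card_sigma, Finset.sum_range_succ, ← Finset.sum_range_id]
    congr 1
    · apply Finset.sum_congr rfl
      intro m hm
      simp [Finset.mem_range.mp hm]
    · simp
  have hqq : q = 1 ∨ q + q ≤ q ^ 2 := by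
    rcases Nat.lt_or_ge 1 q with h | h
    · right; nlinarith
    · left; omega
  rw [← hS]
  apply Finset.card_nbij' (fun p => ⟨(q ^ 2 - q - 1 - p.1) + (q - p.2), q - p.2⟩)
    (fun s => (q ^ 2 - q - 1 - (s.1 - s.2), q - s.2))
  · rintro ⟨i, j⟩ h
    simp only [Finset.coe_filter, Finset.mem_product, Finset.mem_range, Set.mem_ofPred_eq] at h
    obtain ⟨⟨hi, hj⟩, h⟩ := h
    rw [aux_val q i j (q ^ 2 - q - 1 - i) (q - j) (by omega) (by omega),
      aux_cond q a b _ _ (by omega) (by omega) (by omega) hb ha] at h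
    simp only [Finset.coe_sigma, Set.mem_sigma_iff, Finset.mem_coe, Finset.mem_range, Finset.mem_Icc]
    split_ifs <;> omega
  · rintro ⟨m, k⟩ h
    simp only [Finset.coe_sigma, Set.mem_sigma_iff, Finset.mem_coe, Finset.mem_range,
      Finset.mem_Icc] at h
    simp only [Finset.coe_filter, Finset.mem_product, Finset.mem_range, Set.mem_ofPred_eq]
    have h' : 1 ≤ k ∧ k ≤ m ∧ (m < a ∨ (m = a ∧ k ≤ b)) := by
      split_ifs at h <;> omega
    obtain ⟨h1, h2, h3⟩ := h'
    refine ⟨⟨by omega, by omega⟩, ?_⟩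
    rw [aux_val q _ _ (m - k) k (by omega) (by omega)]
    rw [aux_cond q a b _ _ (by omega) (by omega) (by omega) hb ha]
    omega
  · rintro ⟨i, j⟩ h
    simp only [Finset.coe_filter, Finset.mem_product, Finset.mem_range, Set.mem_ofPred_eq] at h
    ext <;> simp only <;> omega
  · rintro ⟨m, k⟩ h
    simp only [Finset.coe_sigma, Set.mem_sigma_iff, Finset.mem_coe, Finset.mem_range,
      Finset.mem_Icc] at h
    have h' : 1 ≤ k ∧ k ≤ m ∧ (m < a ∨ (m = a ∧ k ≤ b)) := by
      split_ifs at h <;> omega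
    have e1 : q - (q - k) = k := by omega
    have e2 : (q ^ 2 - q - 1 - (q ^ 2 - q - 1 - (m - k))) + k = m := by omega
    simp only [e1, e2]

lemma good_card (q δ : ℕ) (hq : 1 ≤ q) (hδ : 1 ≤ δ) :
    (((Finset.Ico (q ^ 2 - q) (q ^ 2)) ×ˢ (Finset.range q)).filter
      (fun p => δ ≤ (q ^ 2 - p.1) * (q - p.2))).card
      = ∑ s ∈ Finset.Icc δ (q ^ 2),
            ((Finset.Icc 1 q).filter (fun d => d ∣ s ∧ s / d ≤ q)).card := by
  have hqq : q ≤ q ^ 2 := by nlinarith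
  rw [← Finset.card_sigma]
  apply Finset.card_nbij' (fun p => ⟨(q ^ 2 - p.1) * (q - p.2), q ^ 2 - p.1⟩)
    (fun s => (q ^ 2 - s.2, q - s.1 / s.2))
  · rintro ⟨i, j⟩ h
    simp only [Finset.coe_filter, Finset.mem_product, Finset.mem_range, Finset.mem_Ico,
      Set.mem_ofPred_eq] at h
    obtain ⟨⟨hi, hj⟩, h⟩ := h
    simp only [Finset.coe_sigma, Set.mem_sigma_iff, Finset.mem_coe, Finset.mem_filter,
      Finset.mem_Icc]
    refine ⟨⟨h, ?_⟩, ⟨by omega, by omega⟩, Dvd.intro _ rfl, ?_⟩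
    · rw [pow_two q]
      rw [pow_two] at hi hqq
      exact Nat.mul_le_mul (by omega) (by omega)
    · rw [Nat.mul_div_cancel_left _ (by omega)]; omega
  · rintro ⟨s, d⟩ h
    simp only [Finset.coe_sigma, Set.mem_sigma_iff, Finset.mem_coe, Finset.mem_filter,
      Finset.mem_Icc] at h
    obtain ⟨⟨h1, h2⟩, ⟨h3, h4⟩, ⟨e, rfl⟩, h6⟩ := h
    rw [Nat.mul_div_cancel_left _ (by omega)] at h6
    have he : e ≠ 0 := by rintro rfl; simp at h1; omega
    simp only [Finset.coe_filter, Finset.mem_product, Finset.mem_range, Finset.mem_Ico,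
      Set.mem_ofPred_eq]
    rw [Nat.mul_div_cancel_left _ (by omega)]
    refine ⟨⟨by omega, by omega⟩, ?_⟩
    rwa [Nat.sub_sub_self (by omega), Nat.sub_sub_self h6]
  · rintro ⟨i, j⟩ h
    simp only [Finset.coe_filter, Finset.mem_product, Finset.mem_range, Finset.mem_Ico,
      Set.mem_ofPred_eq] at h
    simp only
    rw [Nat.mul_div_cancel_left _ (by omega)]
    ext <;> simp only <;> omega
  · rintro ⟨s, d⟩ h
    simp only [Finset.coe_sigma, Set.mem_sigma_iff, Finset.mem_coe, Finset.mem_filter,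
      Finset.mem_Icc] at h
    obtain ⟨⟨h1, h2⟩, ⟨h3, h4⟩, ⟨e, rfl⟩, h6⟩ := h
    rw [Nat.mul_div_cancel_left _ (by omega)] at h6
    simp only
    rw [Nat.mul_div_cancel_left _ (by omega), Nat.sub_sub_self (by omega : d ≤ q ^ 2),
      Nat.sub_sub_self h6]


/-- The combinatorial core of Proposition 2: the number of pairs `(i, j)` with
`0 ≤ i < q²`, `0 ≤ j < q` and `σ(i, j) ≥ δ` equals
`q³ - q² - a(a-1)/2 - min{a,b} + Σ_{s=δ}^{q²} τ⁽q⁾(s)`,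
where `δ - 1 = aq + b` with `0 ≤ b < q`. -/
theorem stmt_9 (q δ a b : ℕ) (hq : 1 ≤ q) (hδ₁ : 1 ≤ δ) (hδ₂ : δ ≤ q ^ 2)
    (hab : δ - 1 = a * q + b) (hb : b < q)
    (σ : ℕ × ℕ → ℕ)
    (hσ₁ : ∀ i j : ℕ, i < q ^ 2 - q → j < q →
      σ (i, j) = q ^ 3 - (i * q + j * (q + 1)))
    (hσ₂ : ∀ i j : ℕ, q ^ 2 - q ≤ i → i < q ^ 2 → j < q →
      σ (i, j) = (q ^ 2 - i) * (q - j)) :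
    Set.ncard {p : ℕ × ℕ | p.1 < q ^ 2 ∧ p.2 < q ∧ δ ≤ σ p}
      = q ^ 3 - q ^ 2 - a * (a - 1) / 2 - min a b
        + ∑ s ∈ Finset.Icc δ (q ^ 2),
            ((Finset.Icc 1 q).filter (fun d => d ∣ s ∧ s / d ≤ q)).card := by
  have ha : a < q := by
    by_contra hc
    have : q * q ≤ a * q := Nat.mul_le_mul_right _ (by omega)
    rw [pow_two] at hδ₂
    omega
  have hqq : q ≤ q ^ 2 := by nlinarith
  have hset : {p : ℕ × ℕ | p.1 < q ^ 2 ∧ p.2 < q ∧ δ ≤ σ p} =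
      ↑((((Finset.range (q ^ 2 - q)) ×ˢ (Finset.range q)).filter
        (fun p => ¬ (q ^ 3 - (p.1 * q + p.2 * (q + 1)) ≤ a * q + b))) ∪
      (((Finset.Ico (q ^ 2 - q) (q ^ 2)) ×ˢ (Finset.range q)).filter
        (fun p => δ ≤ (q ^ 2 - p.1) * (q - p.2)))) := by
    ext ⟨i, j⟩
    simp only [Set.mem_ofPred_eq, Finset.mem_coe, Finset.mem_union, Finset.mem_filter,
      Finset.mem_product, Finset.mem_range, Finset.mem_Ico]
    by_cases hj : j < q
    · by_cases hi : i < q ^ 2 - q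
      · rw [hσ₁ i j hi hj]
        omega
      · by_cases hi2 : i < q ^ 2
        · rw [hσ₂ i j (by omega) hi2 hj]
          have hi3 : q ^ 2 - q ≤ i := by omega
          simp [hi, hi2, hj, hi3]
        · simp [hi, hi2]
    · simp [hj]
  rw [hset, Set.ncard_coe_finset, Finset.card_union_of_disjoint, good_card q δ hq hδ₁]
  · congr 1
    have h := Finset.card_filter_add_card_filter_not
      (s := (Finset.range (q ^ 2 - q)) ×ˢ (Finset.range q))
      (fun p : ℕ × ℕ => q ^ 3 - (p.1 * q + p.2 * (q + 1)) ≤ a * q + b)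
    rw [bad_card q a b hb ha, Finset.card_product, Finset.card_range, Finset.card_range,
      Nat.sub_mul, ← pow_two, ← pow_succ, show 2 + 1 = 3 from rfl] at h
    omega
  · rw [Finset.disjoint_left]
    rintro ⟨i, j⟩ h1 h2
    simp only [Finset.mem_filter, Finset.mem_product, Finset.mem_range, Finset.mem_Ico] at h1 h2
    omega
end

section
/- Let q be a prime power and F a finite field with q² elements. The set P = {(a, b) ∈ F × F : b^q + b = a^{q+1}} of affine rational points of the Hermitian curve has exactly q³ elements, and the q³ vectors ev(i, j) = ((a^i · b^j))_{(a,b) ∈ P} ∈ F^P, for 0 ≤ i < q² and 0 ≤ j < q, are linearly independent over F (hence form a basis of F^P). -/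
theorem herm_vanish {F : Type*} [Field F] (n : ℕ) (c : Fin n → F) (s : Finset F)
    (hs : n ≤ s.card) (h : ∀ x ∈ s, ∑ i, c i * x ^ (i : ℕ) = 0) : ∀ i, c i = 0 := by
  classical
  let f : Polynomial F := ∑ i : Fin n, Polynomial.C (c i) * Polynomial.X ^ (i : ℕ)
  have hdeg : f.degree < s.card := by
    refine lt_of_lt_of_le ?_ (Nat.cast_le.mpr hs)
    exact Polynomial.degree_sum_fin_lt c
  have hf : f = 0 := by
    apply Polynomial.eq_zero_of_degree_lt_of_eval_finset_eq_zero s hdeg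
    intro x hx
    simpa [f, Polynomial.eval_finset_sum] using h x hx
  intro i
  have h2 : f.coeff (i : ℕ) = c i := by
    simp [f, Polynomial.finset_sum_coeff, Polynomial.coeff_X_pow, Fin.val_inj]
  rw [← h2, hf, Polynomial.coeff_zero]

theorem herm_root_card {F : Type*} [Field F] [Fintype F] [DecidableEq F] (q : ℕ)
    (f : Polynomial F) (hf : f.degree = q) (s : Finset F) (h : ∀ x ∈ s, f.eval x = 0) :
    s.card ≤ q := by
  by_contra hlt
  have h0 : f = 0 := by
    apply Polynomial.eq_zero_of_degree_lt_of_eval_finset_eq_zero s _ h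
    rw [hf]
    exact Nat.cast_lt.mpr (not_le.mp hlt)
  simp [h0] at hf

theorem herm_fiber {F : Type*} [Field F] [Fintype F] [DecidableEq F] (q : ℕ)
    (hq : IsPrimePow q) (hF : Fintype.card F = q ^ 2) (a : F) :
    (Finset.univ.filter (fun b : F => b ^ q + b = a ^ (q + 1))).card = q := by
  have hq1 : 1 < q := hq.one_lt
  have hqq : ∀ x : F, x ^ (q * q) = x := fun x => by
    rw [← sq, ← hF]; exact FiniteField.pow_card x
  have hadd : ∀ x y : F, (x + y) ^ q = x ^ q + y ^ q := by
    obtain ⟨p, k, hp, hk, rfl⟩ := hq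
    have hp' : p.Prime := hp.nat_prime
    haveI : Fact p.Prime := ⟨hp'⟩
    haveI : CharP F p := by
      apply charP_of_card_eq_prime_pow (f := k * 2)
      rw [hF, pow_mul]
    intro x y
    exact add_pow_char_pow x y ..
  let S : Finset F := Finset.univ.filter (fun c : F => c ^ q = c)
  have hS : S.card ≤ q := by
    apply herm_root_card q (Polynomial.X ^ q - Polynomial.X)
    · rw [Polynomial.degree_sub_eq_left_of_degree_lt] <;> simp [hq1]
    · intro x hx
      simp [S] at hx
      simp [hx]
  let fib : F → Finset F := fun c => Finset.univ.filter (fun b : F => b ^ q + b = c)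
  have hfib : ∀ c, (fib c).card ≤ q := by
    intro c
    apply herm_root_card q (Polynomial.X ^ q + (Polynomial.X - Polynomial.C c))
    · rw [Polynomial.degree_add_eq_left_of_degree_lt] <;> simp [hq1]
    · intro x hx
      simp [fib] at hx
      simp [← hx]
  have hsum : ∑ c ∈ S, (fib c).card = q ^ 2 := by
    rw [← hF, ← Finset.card_univ]
    symm
    apply Finset.card_eq_sum_card_fiberwise
    intro b _
    simp [S, hadd, ← pow_mul, hqq, add_comm]
  have haS : a ^ (q + 1) ∈ S := by
    simp only [S, Finset.mem_filter, Finset.mem_univ, true_and]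
    rw [← pow_mul, add_mul, pow_add, hqq, one_mul, pow_succ, mul_comm]
  by_contra hne
  have hlt : (fib (a ^ (q + 1))).card < q := lt_of_le_of_ne (hfib _) hne
  have : ∑ c ∈ S, (fib c).card < ∑ c ∈ S, q :=
    Finset.sum_lt_sum (fun c _ => hfib c) ⟨_, haS, hlt⟩
  rw [hsum, Finset.sum_const, smul_eq_mul] at this
  nlinarith

/-- The Hermitian curve `b^q + b = a^{q+1}` over a field with `q²` elements has
exactly `q³` affine rational points, and the `q³` evaluation vectors
`ev(i,j) = ((aⁱbʲ))_{(a,b) ∈ P}` for `0 ≤ i < q²`, `0 ≤ j < q` are linearly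
independent (hence form a basis of `F^P`). -/
theorem stmt_10 (q : ℕ) (hq : IsPrimePow q) (F : Type*) [Field F] [Fintype F]
    (hF : Fintype.card F = q ^ 2) :
    Nat.card {x : F × F // x.2 ^ q + x.2 = x.1 ^ (q + 1)} = q ^ 3 ∧
    LinearIndependent F
      (fun ij : Fin (q ^ 2) × Fin q =>
        (fun x : {x : F × F // x.2 ^ q + x.2 = x.1 ^ (q + 1)} =>
          x.1.1 ^ (ij.1 : ℕ) * x.1.2 ^ (ij.2 : ℕ))) := by
  classical
  constructor
  · rw [Nat.card_eq_fintype_card, Fintype.card_subtype,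
      Finset.card_eq_sum_card_fiberwise (f := Prod.fst) (t := Finset.univ) (by simp)]
    have : ∀ a ∈ (Finset.univ : Finset F),
        (Finset.filter (fun x : F × F => x.1 = a)
          (Finset.univ.filter (fun x : F × F => x.2 ^ q + x.2 = x.1 ^ (q + 1)))).card = q := by
      intro a _
      refine Eq.trans (Eq.symm ?_) (herm_fiber q hq hF a)
      apply Finset.card_bij (fun b _ => (a, b))
      · intro b hb
        simpa using hb
      · intro b _ c _ h
        simpa using h
      · rintro ⟨x, y⟩ h
        simp at h
        obtain ⟨h, rfl⟩ := h
        exact ⟨y, by simpa using h, rfl⟩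
    rw [Finset.sum_congr rfl this, Finset.sum_const, Finset.card_univ, hF, smul_eq_mul]
    ring
  · rw [Fintype.linearIndependent_iff]
    intro g hg
    have key : ∀ a : F, ∀ j : Fin q, ∑ i : Fin (q ^ 2), g (i, j) * a ^ (i : ℕ) = 0 := by
      intro a
      apply herm_vanish q _ _ (herm_fiber q hq hF a).ge
      intro b hb
      have hb' : b ^ q + b = a ^ (q + 1) := by simpa using hb
      have := congrFun hg ⟨(a, b), hb'⟩
      simp only [Finset.sum_apply, Pi.smul_apply, smul_eq_mul, Pi.zero_apply] at this
      rw [Fintype.sum_prod_type_right] at this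
      rw [← this]
      refine Finset.sum_congr rfl fun j _ => ?_
      rw [Finset.sum_mul]
      refine Finset.sum_congr rfl fun i _ => ?_
      ring
    rintro ⟨i, j⟩
    exact herm_vanish (q ^ 2) (fun i => g (i, j)) Finset.univ
      (by rw [Finset.card_univ, hF]) (fun x _ => key x j) i
end

section
/- Proposition 2 (dimension of the order bound improved Hermitian code): Let q be a prime power, F a finite field with q² elements, and let δ be an integer with 1 ≤ δ ≤ q²; write δ − 1 = a·q + b with 0 ≤ b < q. Then the F-dimension of the code Ẽ(δ) ⊆ F^P equals q³ − q² − a·(a−1)/2 − min{a, b} + Σ_{i=δ}^{q²} τ⁽q⁾(i). -/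
open Finset in
lemma fiber_card (q : ℕ) (hq : IsPrimePow q) (F : Type*) [Field F] [Fintype F] [DecidableEq F]
    (hF : Fintype.card F = q ^ 2) (x : F) :
    q ≤ (univ.filter (fun y : F => y ^ q + y = x ^ (q + 1))).card := by
  have hq1 : 1 < q := hq.one_lt
  have hpowF : ∀ y : F, y ^ (q * q) = y := by
    intro y
    have := FiniteField.pow_card y
    rwa [hF, sq] at this
  have hfrob : ∀ u v : F, (u + v) ^ q = u ^ q + v ^ q := by
    obtain ⟨p, k, hp, hk, rfl⟩ := hq
    have hp' : p.Prime := hp.nat_prime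
    have : Fact p.Prime := ⟨hp'⟩
    have : CharP F p := by
      obtain ⟨r, hr⟩ := CharP.exists F
      obtain ⟨n, hr', hn⟩ := FiniteField.card F r
      have : r ∣ p := by
        apply hr'.dvd_of_dvd_pow (n := k * 2)
        rw [pow_mul, ← hF, hn]
        exact dvd_pow_self _ n.2.ne'
      rw [← (Nat.prime_dvd_prime_iff_eq hr' hp').1 this]
      exact hr
    intro u v
    exact add_pow_char_pow u v p k
  have hfib : ∀ c : F, (univ.filter (fun y : F => y ^ q + y = c)).card ≤ q := by
    intro c
    by_contra! h
    have := Polynomial.eq_zero_of_degree_lt_of_eval_finset_eq_zero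
      (f := (Polynomial.X ^ q + Polynomial.X - Polynomial.C c : Polynomial F))
      (univ.filter (fun y : F => y ^ q + y = c)) (by
        refine lt_of_le_of_lt (b := (q : WithBot ℕ)) ?_ (by exact_mod_cast h)
        compute_degree
        rw [max_le_iff]
        constructor
        · exact le_rfl
        · exact_mod_cast hq1.le) (by
        intro y hy
        simp only [mem_filter, mem_univ, true_and] at hy
        simp [hy])
    have h2 := congrArg (fun f => Polynomial.coeff f q) this
    simp [Polynomial.coeff_X, Polynomial.coeff_C, hq1.ne, show q ≠ 0 by omega] at h2
  set T := univ.filter (fun c : F => c ^ q = c) with hT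
  have hTc : T.card ≤ q := by
    by_contra! h
    have := Polynomial.eq_zero_of_degree_lt_of_eval_finset_eq_zero
      (f := (Polynomial.X ^ q - Polynomial.X : Polynomial F)) T (by
        refine lt_of_le_of_lt (b := (q : WithBot ℕ)) ?_ (by exact_mod_cast h)
        compute_degree
        rw [max_le_iff]
        constructor
        · exact le_rfl
        · exact_mod_cast hq1.le) (by
        intro y hy
        simp only [hT, mem_filter, mem_univ, true_and] at hy
        simp [hy])
    have h2 := congrArg (fun f => Polynomial.coeff f q) this
    simp [Polynomial.coeff_X, hq1.ne] at h2
  have hsum := card_eq_sum_card_fiberwise (s := (univ : Finset F)) (t := T)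
    (f := fun y => y ^ q + y) (by
      intro y _
      simp only [hT, coe_filter, mem_univ, true_and, Set.mem_ofPred_eq]
      rw [hfrob, ← pow_mul, hpowF, add_comm])
  rw [card_univ, hF] at hsum
  have hx : x ^ (q + 1) ∈ T := by
    simp only [hT, mem_filter, mem_univ, true_and]
    rw [← pow_mul, add_mul, pow_add, hpowF, one_mul, pow_succ, mul_comm]
  by_contra! hlt
  have : ∑ c ∈ T, (univ.filter (fun y : F => y ^ q + y = c)).card < ∑ c ∈ T, q :=
    sum_lt_sum (fun c _ => hfib c) ⟨_, hx, hlt⟩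
  rw [sum_const, smul_eq_mul] at this
  nlinarith

lemma poly_coeff_zero {F : Type*} [Field F] (n : ℕ) (c : ℕ → F) (T : Finset F) (hT : n ≤ T.card)
    (h : ∀ y ∈ T, ∑ j ∈ Finset.range n, c j * y ^ j = 0) : ∀ j < n, c j = 0 := by
  intro j hj
  have := Polynomial.eq_zero_of_degree_lt_of_eval_finset_eq_zero
    (f := ∑ j ∈ Finset.range n, Polynomial.C (c j) * Polynomial.X ^ j) T (by
      refine lt_of_lt_of_le (b := (n : WithBot ℕ)) ?_ (by exact_mod_cast hT)
      rw [Polynomial.degree_lt_iff_coeff_zero]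
      intro m hm
      rw [Polynomial.finsetSum_coeff]
      refine Finset.sum_eq_zero fun i hi => ?_
      rw [Finset.mem_range] at hi
      rw [Polynomial.coeff_C_mul_X_pow, if_neg (by omega)]) (by
      intro y hy
      simpa [Polynomial.eval_finsetSum] using h y hy)
  have h2 := congrArg (fun f => Polynomial.coeff f j) this
  simpa [Polynomial.finsetSum_coeff, Polynomial.coeff_X_pow, hj] using h2

lemma ev_indep (q : ℕ) (hq : IsPrimePow q) (F : Type*) [Field F] [Fintype F]
    (hF : Fintype.card F = q ^ 2) :
    LinearIndepOn F (fun (ij : ℕ × ℕ) (x : {x : F × F // x.2 ^ q + x.2 = x.1 ^ (q + 1)}) =>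
      x.1.1 ^ ij.1 * x.1.2 ^ ij.2)
      (↑(Finset.range (q ^ 2) ×ˢ Finset.range q) : Set (ℕ × ℕ)) := by
  classical
  rw [linearIndepOn_finset_iff]
  intro f hf
  have key : ∀ x : F, ∀ j < q, ∑ i ∈ Finset.range (q ^ 2), f (i, j) * x ^ i = 0 := by
    intro x
    apply poly_coeff_zero q (fun j => ∑ i ∈ Finset.range (q ^ 2), f (i, j) * x ^ i) _
      (fiber_card q hq F hF x)
    intro y hy
    simp only [Finset.mem_filter, Finset.mem_univ, true_and] at hy
    have := congrFun hf ⟨(x, y), hy⟩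
    rw [Finset.sum_product_right] at this
    simp only [Finset.sum_apply, Pi.smul_apply, smul_eq_mul, Pi.zero_apply] at this
    rw [← this]
    refine Finset.sum_congr rfl fun j _ => ?_
    rw [Finset.sum_mul]
    exact Finset.sum_congr rfl fun i _ => by ring
  rintro ⟨i, j⟩ hij
  simp only [Finset.mem_product, Finset.mem_range] at hij
  exact poly_coeff_zero (q ^ 2) (fun i => f (i, j)) Finset.univ
    (by rw [Finset.card_univ, hF]) (fun y _ => key y j hij.2) i hij.1

/-- Arithmetic core: which pairs in the first range are removed. -/
lemma bad_iff (q a b k s : ℕ) (hb : b < q) (hs1 : 1 ≤ s) (hs : s ≤ q) :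
    (k + s) * q + s ≤ a * q + b ↔ k + s ≤ a ∧ (k + s = a → s ≤ b) := by
  constructor
  · intro h
    have h1 : k + s ≤ a := by
      by_contra! hlt
      nlinarith
    refine ⟨h1, fun he => ?_⟩
    rw [he] at h
    omega
  · rintro ⟨h1, h2⟩
    rcases h1.lt_or_eq with h | h
    · nlinarith
    · have := h2 h
      rw [h]; omega

lemma sigma_eq (q i j k s : ℕ) (hi : i + k + q + 1 = q ^ 2) (hj : j + s = q) :
    q ^ 3 - (i * q + j * (q + 1)) = (k + s) * q + s := by
  apply Nat.sub_eq_of_eq_add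
  have : q ^ 3 = (i + k + q + 1) * q := by rw [hi]; ring
  rw [this]
  subst hj
  ring

lemma card_bad (q δ a b : ℕ) (hq : 2 ≤ q) (hδ₁ : 1 ≤ δ) (hδ₂ : δ ≤ q ^ 2)
    (hab : δ - 1 = a * q + b) (hb : b < q) :
    ((Finset.range (q ^ 2 - q) ×ˢ Finset.range q).filter
      (fun ij => ¬ δ ≤ q ^ 3 - (ij.1 * q + ij.2 * (q + 1)))).card
      = a * (a - 1) / 2 + min a b := by
  have haq : a < q := by
    by_contra! h
    nlinarith [Nat.sub_lt_of_lt (Nat.lt_succ_of_le hδ₂) (b := 1), Nat.sub_add_cancel hδ₁]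
  have hqq : 2 * q ≤ q ^ 2 := by nlinarith
  have h1 : a * (a - 1) / 2 + min a b =
      ((Finset.range (a + 1)).sigma
        (fun t => Finset.Icc 1 (if t < a then t else min a b))).card := by
    rw [Finset.card_sigma, Finset.sum_range_succ]
    simp only [lt_irrefl, if_false, Nat.card_Icc, Nat.add_sub_cancel]
    rw [← Finset.sum_range_id]
    congr 1
    refine Finset.sum_congr rfl fun t ht => ?_
    rw [if_pos (Finset.mem_range.1 ht)]
  rw [h1]
  refine Finset.card_nbij' (fun ij => ⟨(q ^ 2 - q - 1 - ij.1) + (q - ij.2), q - ij.2⟩)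
    (fun p => (q ^ 2 - q - 1 - (p.1 - p.2), q - p.2)) ?_ ?_ ?_ ?_
  · rintro ⟨i, j⟩ h
    simp only [Finset.coe_filter, Finset.mem_product, Finset.mem_range, Set.mem_ofPred_eq] at h
    obtain ⟨⟨hi, hj⟩, h⟩ := h
    rw [sigma_eq q i j (q ^ 2 - q - 1 - i) (q - j) (by omega) (by omega)] at h
    have := (bad_iff q a b (q ^ 2 - q - 1 - i) (q - j) hb (by omega) (by omega)).1 (by omega)
    simp only [Finset.coe_sigma, Set.mem_sigma_iff, Finset.mem_coe, Finset.mem_range,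
      Finset.mem_Icc]
    split_ifs <;> omega
  · rintro ⟨t, s⟩ h
    simp only [Finset.coe_sigma, Set.mem_sigma_iff, Finset.mem_coe, Finset.mem_range,
      Finset.mem_Icc] at h
    have h3 : s ≤ t ∧ (t = a → s ≤ b) := by
      obtain ⟨_, h⟩ := h
      split_ifs at h <;> omega
    have := (bad_iff q a b (t - s) s hb (by omega) (by omega)).2 (by omega)
    simp only [Finset.coe_filter, Finset.mem_product, Finset.mem_range, Set.mem_ofPred_eq]
    rw [sigma_eq q _ _ (t - s) s (by omega) (by omega)]
    omega
  · rintro ⟨i, j⟩ h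
    simp only [Finset.coe_filter, Finset.mem_product, Finset.mem_range, Set.mem_ofPred_eq] at h
    simp only [Prod.mk.injEq]
    omega
  · rintro ⟨t, s⟩ h
    simp only [Finset.coe_sigma, Set.mem_sigma_iff, Finset.mem_coe, Finset.mem_range,
      Finset.mem_Icc] at h
    have h3 : s ≤ t := by
      obtain ⟨_, h⟩ := h
      split_ifs at h <;> omega
    simp only [Sigma.mk.injEq, heq_eq_eq]
    omega

lemma card_second (q δ : ℕ) (hq : 2 ≤ q) (hδ₁ : 1 ≤ δ) :
    ((Finset.Ico (q ^ 2 - q) (q ^ 2) ×ˢ Finset.range q).filter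
      (fun ij => δ ≤ (q ^ 2 - ij.1) * (q - ij.2))).card
      = ∑ i ∈ Finset.Icc δ (q ^ 2),
            ((Finset.Icc 1 q).filter (fun d => d ∣ i ∧ i / d ≤ q)).card := by
  have hqq : 2 * q ≤ q ^ 2 := by nlinarith
  rw [Finset.card_eq_sum_card_fiberwise (t := Finset.Icc δ (q ^ 2))
    (f := fun ij => (q ^ 2 - ij.1) * (q - ij.2))]
  · refine Finset.sum_congr rfl fun n hn => ?_
    rw [Finset.mem_Icc] at hn
    refine Finset.card_nbij' (fun ij => q - ij.2) (fun d => (q ^ 2 - n / d, q - d)) ?_ ?_ ?_ ?_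
    · rintro ⟨i, j⟩ h
      simp only [Finset.coe_filter, Finset.mem_filter, Finset.mem_product, Finset.mem_range,
        Finset.mem_Ico, Set.mem_ofPred_eq, Finset.mem_Icc] at h ⊢
      obtain ⟨⟨⟨hi, hj⟩, _⟩, h⟩ := h
      refine ⟨by omega, ⟨_, (mul_comm _ _).trans h |>.symm⟩, ?_⟩
      rw [← h, Nat.mul_div_cancel _ (by omega)]
      omega
    · rintro d h
      simp only [Finset.coe_filter, Finset.mem_filter, Finset.mem_product, Finset.mem_range,
        Finset.mem_Ico, Set.mem_ofPred_eq, Finset.mem_Icc] at h ⊢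
      obtain ⟨hd, hdn, h⟩ := h
      have hpos : 0 < n / d := Nat.div_pos (Nat.le_of_dvd (by omega) hdn) (by omega)
      have e : (q ^ 2 - (q ^ 2 - n / d)) * (q - (q - d)) = n := by
        rw [show q ^ 2 - (q ^ 2 - n / d) = n / d by omega, show q - (q - d) = d by omega]
        exact Nat.div_mul_cancel hdn
      rw [e]
      omega
    · rintro ⟨i, j⟩ h
      simp only [Finset.coe_filter, Finset.mem_filter, Finset.mem_product, Finset.mem_range,
        Finset.mem_Ico, Set.mem_ofPred_eq] at h
      obtain ⟨⟨⟨hi, hj⟩, _⟩, h⟩ := h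
      simp only [Prod.mk.injEq]
      rw [← h, Nat.mul_div_cancel _ (by omega)]
      omega
    · rintro d h
      simp only [Finset.coe_filter, Set.mem_ofPred_eq, Finset.mem_Icc] at h
      simp only
      omega
  · rintro ⟨i, j⟩ h
    simp only [Finset.coe_filter, Finset.mem_product, Finset.mem_range,
        Finset.mem_Ico, Set.mem_ofPred_eq, Finset.coe_Icc, Set.mem_Icc] at h ⊢
    refine ⟨h.2, ?_⟩
    rw [sq q]
    rw [sq q] at h
    exact Nat.mul_le_mul (by omega) (by omega)

/-- Proposition 2: the dimension of the order bound improved Hermitian code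
`Ẽ(δ)` equals `q³ - q² - a(a-1)/2 - min{a,b} + Σ_{i=δ}^{q²} τ⁽q⁾(i)`,
where `δ - 1 = aq + b` with `0 ≤ b < q`. -/
theorem stmt_11 (q : ℕ) (hq : IsPrimePow q) (F : Type*) [Field F] [Fintype F]
    (hF : Fintype.card F = q ^ 2) (δ a b : ℕ) (hδ₁ : 1 ≤ δ) (hδ₂ : δ ≤ q ^ 2)
    (hab : δ - 1 = a * q + b) (hb : b < q)
    (E : Submodule F ({x : F × F // x.2 ^ q + x.2 = x.1 ^ (q + 1)} → F))
    (hE : E = Submodule.span F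
      {v : {x : F × F // x.2 ^ q + x.2 = x.1 ^ (q + 1)} → F |
        ∃ i j : ℕ, i < q ^ 2 ∧ j < q ∧
          δ ≤ (if i < q ^ 2 - q then q ^ 3 - (i * q + j * (q + 1))
               else (q ^ 2 - i) * (q - j)) ∧
          v = fun x => x.1.1 ^ i * x.1.2 ^ j}) :
    Module.finrank F E
      = q ^ 3 - q ^ 2 - a * (a - 1) / 2 - min a b
        + ∑ i ∈ Finset.Icc δ (q ^ 2),
            ((Finset.Icc 1 q).filter (fun d => d ∣ i ∧ i / d ≤ q)).card := by
  classical
  have hq2 : 2 ≤ q := hq.one_lt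
  have hqq : 2 * q ≤ q ^ 2 := by nlinarith
  set good : ℕ × ℕ → Prop := fun ij => δ ≤ (if ij.1 < q ^ 2 - q
    then q ^ 3 - (ij.1 * q + ij.2 * (q + 1)) else (q ^ 2 - ij.1) * (q - ij.2)) with hgood
  set S := (Finset.range (q ^ 2) ×ˢ Finset.range q).filter good with hS
  have hind := (ev_indep q hq F hF).mono (t := (S : Set (ℕ × ℕ)))
    (by rw [hS]; exact_mod_cast Finset.filter_subset _ _)
  have hEcard : Module.finrank F E = S.card := by
    have h1 := finrank_span_eq_card hind
    rw [← Nat.card_eq_fintype_card, Nat.card_coe_set_eq, Set.ncard_coe_finset] at h1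
    rw [← h1, hE]
    refine congrArg (fun A => Module.finrank F (Submodule.span F A)) ?_
    ext v
    simp only [Set.mem_ofPred_eq, Set.mem_range, Subtype.exists, Prod.exists, hS, hgood,
      Finset.coe_filter, Finset.mem_product, Finset.mem_range]
    constructor
    · rintro ⟨i, j, hi, hj, h, rfl⟩
      exact ⟨i, j, ⟨⟨hi, hj⟩, h⟩, rfl⟩
    · rintro ⟨i, j, ⟨⟨hi, hj⟩, h⟩, rfl⟩
      exact ⟨i, j, hi, hj, h, rfl⟩
  have hbad := card_bad q δ a b hq2 hδ₁ hδ₂ hab hb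
  have hsplit := Finset.card_filter_add_card_filter_not
    (s := Finset.range (q ^ 2 - q) ×ˢ Finset.range q)
    (fun ij => δ ≤ q ^ 3 - (ij.1 * q + ij.2 * (q + 1)))
  rw [hbad, Finset.card_product, Finset.card_range, Finset.card_range, Nat.sub_mul,
    ← pow_succ, ← sq] at hsplit
  have hSS : S = ((Finset.range (q ^ 2 - q) ×ˢ Finset.range q).filter
      (fun ij => δ ≤ q ^ 3 - (ij.1 * q + ij.2 * (q + 1)))) ∪
      ((Finset.Ico (q ^ 2 - q) (q ^ 2) ×ˢ Finset.range q).filter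
      (fun ij => δ ≤ (q ^ 2 - ij.1) * (q - ij.2))) := by
    ext ⟨i, j⟩
    simp only [hS, hgood, Finset.mem_union, Finset.mem_filter, Finset.mem_product,
      Finset.mem_range, Finset.mem_Ico]
    by_cases h : i < q ^ 2 - q
    · rw [if_pos h]
      constructor
      · rintro ⟨h1, h2⟩
        exact Or.inl ⟨⟨h, h1.2⟩, h2⟩
      · rintro (⟨h1, h2⟩ | ⟨h1, h2⟩)
        · exact ⟨⟨by omega, h1.2⟩, h2⟩
        · omega
    · rw [if_neg h]
      constructor
      · rintro ⟨h1, h2⟩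
        exact Or.inr ⟨⟨⟨by omega, h1.1⟩, h1.2⟩, h2⟩
      · rintro (⟨h1, h2⟩ | ⟨h1, h2⟩)
        · omega
        · exact ⟨⟨h1.1.2, h1.2⟩, h2⟩
  rw [hEcard, hSS, Finset.card_union_of_disjoint, card_second q δ hq2 hδ₁]
  · norm_num at hsplit ⊢
    omega
  · rw [Finset.disjoint_left]
    rintro ⟨i, j⟩ h1 h2
    simp only [Finset.mem_filter, Finset.mem_product, Finset.mem_range, Finset.mem_Ico] at h1 h2
    omega
end

section
/- Proposition 4 (dual-containment of one-point Hermitian codes): Let q be a prime power, F a finite field with q² elements, and let δ be an integer with 1 ≤ δ ≤ q³. The one-point Hermitian code C(q³ − δ) ⊆ F^P contains its Euclidean dual, i.e. C(q³ − δ)^⊥ ⊆ C(q³ − δ), if and only if δ ≤ ⌊(q³ − q² + q)/2⌋ + 1. -/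
namespace Herm

open Polynomial in
lemma sum_eval {F : Type*} [Field F] [Fintype F] (f : F[X])
    (hf : f.natDegree ≤ Fintype.card F - 1) :
    ∑ x : F, f.eval x = - f.coeff (Fintype.card F - 1) := by
  classical
  have h1 : ∀ k ∈ Finset.range (Fintype.card F - 1), f.coeff k * ∑ x : F, x ^ k = 0 := by
    intro k hk
    rw [FiniteField.sum_pow_lt_card_sub_one F k (Finset.mem_range.1 hk), mul_zero]
  have hc : 1 < Fintype.card F := Fintype.one_lt_card
  have h2 : ∑ x : F, x ^ (Fintype.card F - 1) = -1 := by
    have : ∀ x : F, x ^ (Fintype.card F - 1) = 1 - (if x = 0 then 1 else 0) := by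
      intro x
      by_cases hx : x = 0
      · subst hx
        rw [zero_pow (by omega)]; simp
      · rw [FiniteField.pow_card_sub_one_eq_one x hx]; simp [hx]
    simp [this]
  simp_rw [eval_eq_sum_range' (Nat.lt_succ_of_le hf)]
  rw [Finset.sum_comm]
  simp_rw [← Finset.mul_sum]
  rw [Finset.sum_range_succ, Finset.sum_eq_zero h1, h2]
  ring

section
variable {q : ℕ} {F : Type*} [Field F] [Fintype F] [DecidableEq F]

lemma add_pow_q (hq : IsPrimePow q) (hF : Fintype.card F = q ^ 2) (x y : F) :
    (x + y) ^ q = x ^ q + y ^ q ∧ (x - y) ^ q = x ^ q - y ^ q := by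
  obtain ⟨p, n, hp, hn, rfl⟩ := hq
  have hp' : p.Prime := hp.nat_prime
  have : Fact p.Prime := ⟨hp'⟩
  obtain ⟨r, hr⟩ := CharP.exists F
  have hrp : r.Prime := CharP.char_is_prime F r
  have : r ∣ (p ^ n) ^ 2 := by
    rw [← hF]
    exact (CharP.cast_eq_zero_iff F r _).1 (FiniteField.cast_card_eq_zero F)
  have h : r = p := (Nat.prime_dvd_prime_iff_eq hrp hp').1
    (hrp.dvd_of_dvd_pow (hrp.dvd_of_dvd_pow this))
  subst h
  exact ⟨add_pow_char_pow x y _ _, sub_pow_char_pow x y _⟩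

lemma ind (hq : IsPrimePow q) (hF : Fintype.card F = q ^ 2) (x y : F) :
    (if y ^ q + y = x ^ (q + 1) then (1 : F) else 0)
      = 1 - (y ^ q + y - x ^ (q + 1)) ^ (q - 1) := by
  have hq2 : 2 ≤ q := hq.two_le
  have hpow : ∀ z : F, (z ^ q) ^ q = z := by
    intro z
    rw [← pow_mul, ← sq, ← hF, FiniteField.pow_card]
  split_ifs with h
  · rw [h, sub_self, zero_pow (by omega), sub_zero]
  · have hne : y ^ q + y - x ^ (q + 1) ≠ 0 := sub_ne_zero.2 h
    set t := y ^ q + y - x ^ (q + 1) with ht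
    have : t ^ q = t := by
      rw [ht, (add_pow_q hq hF _ _).2, (add_pow_q hq hF _ _).1, hpow, pow_succ, mul_pow, hpow]
      ring
    have h2 : t ^ (q - 1) * t = 1 * t := by
      rw [← pow_succ, Nat.sub_add_cancel (by omega), this, one_mul]
    rw [mul_right_cancel₀ hne h2, sub_self]

/-- power sums over a fibre -/
noncomputable def ps (q : ℕ) (x : F) (j : ℕ) : F :=
  ∑ y : F, if y ^ q + y = x ^ (q + 1) then y ^ j else 0

open Polynomial in
lemma ps_low (hq : IsPrimePow q) (hF : Fintype.card F = q ^ 2) (x : F) (j : ℕ) (hj : j < q) :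
    ps q x j = if j = q - 1 then 1 else 0 := by
  have hq2 : 2 ≤ q := hq.two_le
  set g : F[X] := (X ^ q + X - C (x ^ (q + 1))) with hg
  have hgm : g.natDegree = q ∧ g.Monic := by
    have : g = X ^ q + (X - C (x ^ (q + 1))) := by rw [hg]; ring
    have hlt : (X - C (x ^ (q + 1)) : F[X]).degree < q := by
      rw [degree_X_sub_C]; exact_mod_cast hq2
    refine ⟨?_, ?_⟩
    · rw [this, natDegree_add_eq_left_of_degree_lt, natDegree_X_pow]
      rw [degree_X_pow]; exact hlt
    · rw [this]; exact monic_X_pow_add hlt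
  have hM : (X ^ j * g ^ (q - 1)).Monic := (monic_X_pow j).mul (hgm.2.pow _)
  have hD : (X ^ j * g ^ (q - 1)).natDegree = j + (q - 1) * q := by
    rw [(monic_X_pow j).natDegree_mul (hgm.2.pow _), hgm.2.natDegree_pow, hgm.1, natDegree_X_pow]
  have hcard : Fintype.card F - 1 = (q - 1) + (q - 1) * q := by
    rw [hF]
    obtain ⟨r, rfl⟩ : ∃ r, q = r + 1 := ⟨q - 1, by omega⟩
    simp only [Nat.add_sub_cancel]
    rw [Nat.sub_eq_iff_eq_add (Nat.pos_of_ne_zero (by positivity))]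
    ring
  have h1 : ps q x j = ∑ y : F, y ^ j - ∑ y : F, (X ^ j * g ^ (q - 1)).eval y := by
    rw [ps, ← Finset.sum_sub_distrib]
    refine Finset.sum_congr rfl fun y _ => ?_
    have := ind hq hF x y
    have h3 : (if y ^ q + y = x ^ (q + 1) then y ^ j else 0)
      = y ^ j * (if y ^ q + y = x ^ (q + 1) then (1 : F) else 0) := by simp
    rw [h3, this]
    simp [hg]
    ring
  rw [h1, FiniteField.sum_pow_lt_card_sub_one F j, sum_eval _ (by rw [hD, hcard]; omega)]
  · split_ifs with h
    · subst h
      rw [hcard, ← hD]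
      have := hM.coeff_natDegree
      rw [this]; ring
    · rw [coeff_eq_zero_of_natDegree_lt]
      · simp
      · rw [hD, hcard]; omega
  · rw [hcard]
    have : 0 < (q - 1) * q := Nat.mul_pos (by omega) (by omega)
    omega

lemma ps_rec (x : F) (j : ℕ) : ps q x (q + j) = x ^ (q + 1) * ps q x j - ps q x (j + 1) := by
  simp only [ps]
  rw [Finset.mul_sum, ← Finset.sum_sub_distrib]
  refine Finset.sum_congr rfl fun y _ => ?_
  split_ifs with h
  · rw [← h]; ring
  · ring

lemma ps_all (hq : IsPrimePow q) (hF : Fintype.card F = q ^ 2) (x : F) (j : ℕ)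
    (hj : j ≤ 2 * q - 2) :
    ps q x j = if j = q - 1 then 1 else if j = 2 * q - 2 then -1 else 0 := by
  have hq2 : 2 ≤ q := hq.two_le
  by_cases h : j < q
  · rw [ps_low hq hF x j h]
    by_cases h1 : j = q - 1
    · simp [h1]
    · rw [if_neg h1, if_neg h1, if_neg (by omega)]
  · obtain ⟨k, rfl⟩ : ∃ k, j = q + k := ⟨j - q, by omega⟩
    rw [ps_rec, ps_low hq hF x k (by omega), ps_low hq hF x (k + 1) (by omega),
      if_neg (by omega), if_neg (show ¬ (q + k = q - 1) by omega)]
    by_cases h1 : k + 1 = q - 1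
    · rw [if_pos h1, if_pos (by omega)]; ring
    · rw [if_neg h1, if_neg (by omega)]; ring

abbrev P (q : ℕ) (F : Type*) [Field F] := {x : F × F // x.2 ^ q + x.2 = x.1 ^ (q + 1)}

lemma sum_P (a b : ℕ) : ∑ z : P q F, z.1.1 ^ a * z.1.2 ^ b = ∑ x : F, x ^ a * ps q x b := by
  have h := Finset.sum_subtype_eq_sum_filter (s := (Finset.univ : Finset (F × F)))
    (fun z : F × F => z.1 ^ a * z.2 ^ b) (p := fun x => x.2 ^ q + x.2 = x.1 ^ (q + 1))
  rw [Finset.subtype_univ] at h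
  rw [h, Finset.sum_filter, Fintype.sum_prod_type]
  refine Finset.sum_congr rfl fun x _ => ?_
  rw [ps, Finset.mul_sum]
  refine Finset.sum_congr rfl fun y _ => ?_
  simp

lemma sum_zero (hq : IsPrimePow q) (hF : Fintype.card F = q ^ 2) (a b : ℕ)
    (hb : b ≤ 2 * q - 2) (h : a * q + b * (q + 1) + q + 1 < q ^ 3 + q ^ 2) :
    ∑ z : P q F, z.1.1 ^ a * z.1.2 ^ b = 0 := by
  have hq2 : 2 ≤ q := hq.two_le
  rw [sum_P]
  simp_rw [ps_all hq hF _ b hb]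
  rw [← Finset.sum_mul]
  by_cases hb1 : b < q - 1
  · rw [if_neg (by omega), if_neg (by omega), mul_zero]
  · rw [FiniteField.sum_pow_lt_card_sub_one, zero_mul]
    rw [hF]
    by_contra hcon
    have h1 : q ^ 2 ≤ a + 1 := by omega
    have h2 : q ≤ b + 1 := by omega
    nlinarith [Nat.mul_le_mul_right q h1, Nat.mul_le_mul_right (q + 1) h2]

lemma sum_ne (hq : IsPrimePow q) (hF : Fintype.card F = q ^ 2) :
    ∑ z : P q F, z.1.1 ^ (q ^ 2 - 1) * z.1.2 ^ (q - 1) ≠ 0 := by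
  have hq2 : 2 ≤ q := hq.two_le
  rw [sum_P]
  simp_rw [ps_all hq hF _ (q - 1) (by omega)]
  have := sum_eval (F := F) (Polynomial.X ^ (q ^ 2 - 1)) (by rw [Polynomial.natDegree_X_pow, hF])
  rw [hF] at this
  simp at this
  simp [this]

lemma card_P (hq : IsPrimePow q) (hF : Fintype.card F = q ^ 2) :
    Fintype.card (P q F) ≤ q ^ 2 * q := by
  have hq2 : 2 ≤ q := hq.two_le
  have h := Finset.card_le_mul_card_image (s := (Finset.univ : Finset (P q F)))
    (f := fun z => z.1.1) q ?_
  · rw [Finset.card_univ] at h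
    refine h.trans ?_
    rw [mul_comm, ← hF]
    exact Nat.mul_le_mul_right _ (Finset.card_le_univ _)
  · intro x _
    set g : Polynomial F := Polynomial.X ^ q + (Polynomial.X - Polynomial.C (x ^ (q + 1))) with hg
    have hlt : (Polynomial.X - Polynomial.C (x ^ (q + 1)) : Polynomial F).degree < q := by
      rw [Polynomial.degree_X_sub_C]; exact_mod_cast hq2
    have hm : g.Monic := Polynomial.monic_X_pow_add hlt
    have hd : g.natDegree = q := by
      rw [hg, Polynomial.natDegree_add_eq_left_of_degree_lt, Polynomial.natDegree_X_pow]
      rw [Polynomial.degree_X_pow]; exact hlt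
    calc _ ≤ g.roots.toFinset.card := by
          refine Finset.card_le_card_of_injOn (fun z => z.1.2) ?_ ?_
          · intro z hz
            simp only [Finset.coe_filter, Finset.mem_univ, true_and, Set.mem_ofPred_eq] at hz
            have := z.2
            simp only [Finset.mem_coe, Multiset.mem_toFinset]
            rw [Polynomial.mem_roots hm.ne_zero, Polynomial.IsRoot, hg]
            simp [← hz, ← this]
          · intro z hz w hw h
            simp only [Finset.coe_filter, Finset.mem_univ, true_and, Set.mem_ofPred_eq] at hz hw
            exact Subtype.ext (Prod.ext (hz.trans hw.symm) h)
      _ ≤ Multiset.card g.roots := Multiset.toFinset_card_le _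
      _ ≤ g.natDegree := Polynomial.card_roots' g
      _ = q := hd

/-- monomial vector -/
def ev (q : ℕ) (F : Type*) [Field F] (i j : ℕ) : P q F → F := fun z => z.1.1 ^ i * z.1.2 ^ j

lemma pair_ev (i j k l : ℕ) : ∑ z : P q F, ev q F i j z * ev q F k l z =
    ∑ z : P q F, z.1.1 ^ (i + k) * z.1.2 ^ (j + l) := by
  refine Finset.sum_congr rfl fun z _ => ?_
  simp only [ev]; ring

/-- weight -/
def w (k : Fin (q ^ 2) × Fin q) : ℕ := k.1 * q + k.2 * (q + 1)

lemma w_inj (k l : Fin (q ^ 2) × Fin q) (h : w k = w l) : k = l := by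
  obtain ⟨⟨i, hi⟩, ⟨j, hj⟩⟩ := k
  obtain ⟨⟨i', hi'⟩, ⟨j', hj'⟩⟩ := l
  simp only [w] at h
  have e1 : j + q * (i + j) = j' + q * (i' + j') := by linarith
  have hm : j = j' := by
    have := congrArg (· % q) e1
    simpa [Nat.add_mul_mod_self_left, Nat.mod_eq_of_lt hj, Nat.mod_eq_of_lt hj'] using this
  subst hm
  have : i + j = i' + j := Nat.eq_of_mul_eq_mul_left (show 0 < q by omega) (by omega)
  have : i = i' := by omega
  subst this; rfl

lemma w_rev (k : Fin (q ^ 2) × Fin q) : w k + w (k.1.rev, k.2.rev) + q + 1 = q ^ 3 + q ^ 2 := by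
  obtain ⟨⟨i, hi⟩, ⟨j, hj⟩⟩ := k
  simp only [w, Fin.rev]
  obtain ⟨a, ha⟩ : ∃ a, q ^ 2 = i + 1 + a := ⟨q ^ 2 - (i + 1), by omega⟩
  obtain ⟨b, hb⟩ : ∃ b, q = j + 1 + b := ⟨q - (j + 1), by omega⟩
  have e1 : q ^ 2 - (i + 1) = a := by omega
  have e2 : q - (j + 1) = b := by omega
  rw [e1, e2]
  have h1 : q ^ 3 = (i + 1 + a) * q := by rw [← ha]; ring
  have h2 : q ^ 2 + q = (j + 1 + b) * (q + 1) := by rw [← hb]; ring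
  nlinarith

lemma pair_zero (hq : IsPrimePow q) (hF : Fintype.card F = q ^ 2) (i j k l : ℕ)
    (hj : j < q) (hl : l < q)
    (h : (i * q + j * (q + 1)) + (k * q + l * (q + 1)) + q + 1 < q ^ 3 + q ^ 2) :
    ∑ z : P q F, ev q F i j z * ev q F k l z = 0 := by
  rw [pair_ev]
  exact sum_zero hq hF _ _ (by omega) (by linarith)

lemma pair_rev (hq : IsPrimePow q) (hF : Fintype.card F = q ^ 2) (k : Fin (q ^ 2) × Fin q) :
    ∑ z : P q F, ev q F k.1 k.2 z * ev q F k.1.rev k.2.rev z ≠ 0 := by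
  rw [pair_ev]
  have h1 : (k.1 : ℕ) + k.1.rev = q ^ 2 - 1 := by rw [Fin.val_rev]; omega
  have h2 : (k.2 : ℕ) + k.2.rev = q - 1 := by rw [Fin.val_rev]; omega
  rw [h1, h2]
  exact sum_ne hq hF

lemma key (hq : IsPrimePow q) (hF : Fintype.card F = q ^ 2) (c : Fin (q ^ 2) × Fin q → F) (M : ℕ)
    (h : ∀ k : Fin (q ^ 2) × Fin q, M ≤ w k →
      ∑ z : P q F, (∑ l : Fin (q ^ 2) × Fin q, c l • ev q F l.1 l.2) z
        * ev q F k.1.rev k.2.rev z = 0) :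
    ∀ k, M ≤ w k → c k = 0 := by
  intro k hk
  by_contra hc
  obtain ⟨l, hl, hmax⟩ := Finset.exists_max_image
    (Finset.univ.filter fun l => M ≤ w l ∧ c l ≠ 0) w ⟨k, by simp [hk, hc]⟩
  simp only [Finset.mem_filter, Finset.mem_univ, true_and] at hl hmax
  have h0 := h l hl.1
  simp only [Finset.sum_apply, Pi.smul_apply, smul_eq_mul, Finset.sum_mul] at h0
  rw [Finset.sum_comm, Finset.sum_eq_single l] at h0
  · simp_rw [mul_assoc, ← Finset.mul_sum] at h0
    exact (mul_ne_zero hl.2 (pair_rev hq hF l)) h0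
  · intro n _ hn
    simp_rw [mul_assoc, ← Finset.mul_sum]
    by_cases hcn : c n = 0
    · rw [hcn, zero_mul]
    · have hlt : w n < w l := by
        rcases lt_or_ge (w n) (w l) with h | h
        · exact h
        · exact absurd (w_inj n l (le_antisymm (hmax n ⟨hl.1.trans h, hcn⟩) h)) hn
      rw [pair_zero hq hF _ _ _ _ n.2.2 l.2.rev.2, mul_zero]
      have := w_rev l
      simp only [w] at this hlt ⊢
      omega
  · simp

lemma span_top (hq : IsPrimePow q) (hF : Fintype.card F = q ^ 2) (u : P q F → F) :
    ∃ c : Fin (q ^ 2) × Fin q → F, ∑ l : Fin (q ^ 2) × Fin q, c l • ev q F l.1 l.2 = u := by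
  have hli : LinearIndependent F (fun l : Fin (q ^ 2) × Fin q => ev q F l.1 l.2) := by
    rw [Fintype.linearIndependent_iff]
    intro c hc k
    refine key hq hF c 0 ?_ k (Nat.zero_le _)
    intro k _
    rw [hc]; simp
  have hle := hli.fintype_card_le_finrank
  have hcard : Fintype.card (Fin (q ^ 2) × Fin q) = Module.finrank F (P q F → F) := by
    refine le_antisymm hle ?_
    rw [Module.finrank_fintype_fun_eq_card]
    simpa using card_P hq hF
  have htop := hli.span_eq_top_of_card_eq_finrank' hcard
  have : u ∈ Submodule.span F (Set.range fun l : Fin (q ^ 2) × Fin q => ev q F l.1 l.2) := by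
    rw [htop]; trivial
  exact (Submodule.mem_span_range_iff_exists_fun F).1 this

end

end Herm


/-- Proposition 4: the one-point Hermitian code `C(q³ - δ)` contains its
Euclidean dual if and only if `δ ≤ ⌊(q³ - q² + q)/2⌋ + 1`. -/
theorem stmt_12 (q : ℕ) (hq : IsPrimePow q) (F : Type*) [Field F] [Fintype F]
    [DecidableEq F] (hF : Fintype.card F = q ^ 2) (δ : ℕ) (hδ₁ : 1 ≤ δ)
    (hδ₂ : δ ≤ q ^ 3)
    (C : Submodule F ({x : F × F // x.2 ^ q + x.2 = x.1 ^ (q + 1)} → F))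
    (hC : C = Submodule.span F
      {v : {x : F × F // x.2 ^ q + x.2 = x.1 ^ (q + 1)} → F |
        ∃ i j : ℕ, j < q ∧ i * q + j * (q + 1) ≤ q ^ 3 - δ ∧
          v = fun x => x.1.1 ^ i * x.1.2 ^ j}) :
    (∀ u : {x : F × F // x.2 ^ q + x.2 = x.1 ^ (q + 1)} → F,
        (∀ v ∈ C, ∑ x, u x * v x = 0) → u ∈ C)
      ↔ δ ≤ (q ^ 3 - q ^ 2 + q) / 2 + 1 := by
  have hq2 : 2 ≤ q := hq.two_le
  have hq32 : q ^ 2 ≤ q ^ 3 := Nat.pow_le_pow_right (by omega) (by omega)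
  have hqq : 2 * q ≤ q ^ 2 := by nlinarith
  have hq3 : 2 * q ^ 2 ≤ q ^ 3 := by nlinarith [Nat.mul_le_mul_right (q ^ 2) hq2]
  have hmem : ∀ i j : ℕ, j < q → i * q + j * (q + 1) ≤ q ^ 3 - δ → Herm.ev q F i j ∈ C := by
    intro i j hj h
    rw [hC]
    exact Submodule.subset_span ⟨i, j, hj, h, rfl⟩
  have hperp : ∀ i j : ℕ, j < q →
      (i * q + j * (q + 1)) + (q ^ 3 - δ) + q + 1 < q ^ 3 + q ^ 2 →
      ∀ v ∈ C, ∑ z, Herm.ev q F i j z * v z = 0 := by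
    intro i j hj h v hv
    rw [hC] at hv
    induction hv using Submodule.span_induction with
    | mem v hv =>
      obtain ⟨k, l, hl, hw, rfl⟩ := hv
      exact Herm.pair_zero hq hF i j k l hj hl (by omega)
    | zero => simp
    | add x y _ _ hx hy => simp [mul_add, Finset.sum_add_distrib, hx, hy]
    | smul a x _ hx =>
      simp only [Pi.smul_apply, smul_eq_mul]
      simp_rw [mul_left_comm _ a]
      rw [← Finset.mul_sum, hx, mul_zero]
  constructor
  · intro H
    by_contra hδ
    obtain ⟨s, hs1, hs2⟩ : ∃ s, q ^ 3 + q ^ 2 ≤ 2 * s + q + 1 ∧ 2 * s + q + 1 ≤ q ^ 3 + q ^ 2 + 1 :=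
      ⟨(q ^ 3 + q ^ 2 - q) / 2, by omega, by omega⟩
    have hsj : s % q < q := Nat.mod_lt _ (by omega)
    have hsd := Nat.div_add_mod s q
    have hge : q - 1 ≤ s / q := by
      rw [Nat.le_div_iff_mul_le (by omega), Nat.sub_mul]
      have : q * q = q ^ 2 := by ring
      omega
    have hlt : s / q < q ^ 2 := by
      rw [Nat.div_lt_iff_lt_mul (by omega)]
      have : q ^ 2 * q = q ^ 3 := by ring
      omega
    let k : Fin (q ^ 2) × Fin q := (⟨s / q - s % q, by omega⟩, ⟨s % q, hsj⟩)
    have hwk : Herm.w k = s := by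
      obtain ⟨t, ht⟩ : ∃ t, s / q = s % q + t := ⟨s / q - s % q, by omega⟩
      have e : s / q - s % q = t := by omega
      simp only [Herm.w, k, e]
      rw [ht] at hsd
      linarith
    have hrev := Herm.w_rev k
    rw [hwk] at hrev
    have h1 := H _ (hperp k.1 k.2 k.2.2 (by
      change Herm.w k + _ + _ + _ < _
      omega))
    have h2 := hperp k.1.rev k.2.rev k.2.rev.2 (by
      change Herm.w (k.1.rev, k.2.rev) + _ + _ + _ < _
      omega) _ h1
    exact Herm.pair_rev hq hF k ((Finset.sum_congr rfl fun z _ => mul_comm _ _).trans h2)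
  · intro hδ u hu
    obtain ⟨c, rfl⟩ := Herm.span_top hq hF u
    have hc := Herm.key hq hF c (q ^ 2 + δ - q - 1) (by
      intro k hk
      refine hu _ (hmem _ _ k.2.rev.2 ?_)
      change Herm.w (k.1.rev, k.2.rev) ≤ _
      have := Herm.w_rev k
      omega)
    refine Submodule.sum_mem _ fun k _ => ?_
    by_cases hk : q ^ 2 + δ - q - 1 ≤ Herm.w k
    · rw [hc k hk, zero_smul]; exact Submodule.zero_mem _
    · refine Submodule.smul_mem _ _ (hmem _ _ k.2.2 ?_)
      change Herm.w k ≤ _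
      omega
end

section
/- Let q ≥ 1 and δ ≥ 1 be integers. Then, as rational numbers, (1 + 1/q²) · (δ − ⌈(δ−1)/(q²+1)⌉) > δ − 1. (This is the key inequality in the proof of Proposition 5, showing that Steane-enlargement of the one-point Hermitian code by codimension ⌈(δ−1)/(q²+1)⌉ does not decrease the designed minimal distance below δ.) -/
/-- Key inequality of Proposition 5:
`(1 + 1/q²)(δ - ⌈(δ-1)/(q²+1)⌉) > δ - 1` as rational numbers. -/
theorem stmt_15 (q δ : ℕ) (hq : 1 ≤ q) (hδ : 1 ≤ δ) :
    (1 + 1 / (q : ℚ) ^ 2) *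
        ((δ : ℚ) - (⌈((δ : ℚ) - 1) / ((q : ℚ) ^ 2 + 1)⌉ : ℤ))
      > (δ : ℚ) - 1 := by
  have h := Int.ceil_lt_add_one (((δ : ℚ) - 1) / ((q : ℚ) ^ 2 + 1))
  generalize (⌈((δ : ℚ) - 1) / ((q : ℚ) ^ 2 + 1)⌉ : ℤ) = c at h ⊢
  have hq0 : (0 : ℚ) < (q : ℚ) := by exact_mod_cast hq
  have hq2 : (0 : ℚ) < (q : ℚ) ^ 2 := by positivity
  generalize (q : ℚ) ^ 2 = Q at *
  have hpos : 0 < 1 + 1 / Q := by positivity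
  have h1 : (δ : ℚ) - 1 - ((δ : ℚ) - 1) / (Q + 1) < (δ : ℚ) - c := by linarith
  have h2 := mul_lt_mul_of_pos_left h1 hpos
  have h3 : (1 + 1 / Q) * ((δ : ℚ) - 1 - ((δ : ℚ) - 1) / (Q + 1)) = (δ : ℚ) - 1 := by
    have : Q + 1 ≠ 0 := by positivity
    field_simp
    ring
  rw [h3] at h2
  exact h2
end
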